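/- arXiv:1804.01651 — 2 statements merged into one kernel-verified Lean document; each statement's English description precedes it below -/
import Mathlib

section
/- (Theorem 1.2 for r = 1) Let q ∈ ℂ with 0 < |q| < 1 and let a, z ∈ ℂ with |a| < 1. Then (-a z q;q)_∞ / (a q;q)_∞ = 1 + Σ_{N=1}^∞ q^{N²} · [(-a z q;q)_{N-1} / (a q;q)_{N-1}] · [a^N (-z;q)_N / (q;q)_N] · (1 + (1 + z q^N) · a q^N / (1 - a q^N)), where the series converges absolutely and all denominators 1 - a q^m (m ≥ 1) are nonzero since |a q^m| < 1. -/
/-- The finite q-Pochhammer symbol `(a;q)_n = ∏_{k=0}^{n-1} (1 - a q^k)`. -/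
noncomputable def qPoch (a q : ℂ) (n : ℕ) : ℂ := ∏ k ∈ Finset.range n, (1 - a * q ^ k)

/-- The infinite q-Pochhammer symbol `(a;q)_∞ = ∏_{k=0}^∞ (1 - a q^k)`. -/
noncomputable def qPochInf (a q : ℂ) : ℂ := ∏' k : ℕ, (1 - a * q ^ k)

lemma qPoch_succ (c q : ℂ) (n : ℕ) : qPoch c q (n + 1) = qPoch c q n * (1 - c * q ^ n) :=
  Finset.prod_range_succ _ _

lemma qPoch_succ' (c q : ℂ) (n : ℕ) : qPoch c q (n + 1) = (1 - c) * qPoch (c * q) q n := by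
  simp [qPoch, Finset.prod_range_succ', pow_succ', mul_assoc, mul_comm]

lemma norm_qPoch_le {c q : ℂ} {R : ℝ} (hq : ‖q‖ ≤ 1) (hc : ‖c‖ ≤ R) (n : ℕ) :
    ‖qPoch c q n‖ ≤ (1 + R) ^ n := by
  rw [qPoch, norm_prod]
  refine (Finset.prod_le_prod (fun _ _ ↦ norm_nonneg _) (g := fun _ ↦ 1 + R)
    fun k _ ↦ ?_).trans (by simp)
  calc ‖1 - c * q ^ k‖ ≤ ‖(1 : ℂ)‖ + ‖c * q ^ k‖ := norm_sub_le _ _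
    _ ≤ 1 + R := by
      rw [norm_one, norm_mul, norm_pow]
      gcongr
      exact (mul_le_of_le_one_right (norm_nonneg _) (pow_le_one₀ (norm_nonneg _) hq)).trans hc

lemma one_sub_norm_le {c q : ℂ} {R : ℝ} (hq : ‖q‖ ≤ 1) (hc : ‖c‖ ≤ R) (k : ℕ) :
    1 - R ≤ ‖1 - c * q ^ k‖ := by
  have h : ‖c * q ^ k‖ ≤ R := by
    rw [norm_mul, norm_pow]
    exact (mul_le_of_le_one_right (norm_nonneg _) (pow_le_one₀ (norm_nonneg _) hq)).trans hc
  have := norm_sub_norm_le (1 : ℂ) (c * q ^ k)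
  rw [norm_one] at this
  linarith

lemma one_sub_ne_zero {c q : ℂ} (hq : ‖q‖ ≤ 1) (hc : ‖c‖ < 1) (k : ℕ) : 1 - c * q ^ k ≠ 0 :=
  norm_pos_iff.mp ((sub_pos.mpr hc).trans_le (one_sub_norm_le hq le_rfl k))

lemma qPoch_ne_zero {c q : ℂ} (hq : ‖q‖ ≤ 1) (hc : ‖c‖ < 1) (n : ℕ) : qPoch c q n ≠ 0 :=
  Finset.prod_ne_zero_iff.mpr fun k _ ↦ one_sub_ne_zero hq hc k

lemma norm_inv_qPoch_le {c q : ℂ} {R : ℝ} (hq : ‖q‖ ≤ 1) (hc : ‖c‖ ≤ R) (hR : R < 1) (n : ℕ) :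
    ‖(qPoch c q n)⁻¹‖ ≤ (1 - R)⁻¹ ^ n := by
  rw [norm_inv, inv_pow]
  refine inv_anti₀ (pow_pos (sub_pos.mpr hR) n) ?_
  rw [qPoch, norm_prod]
  calc (1 - R) ^ n = ∏ _k ∈ Finset.range n, (1 - R) := by simp
    _ ≤ _ := Finset.prod_le_prod (fun _ _ ↦ (sub_pos.mpr hR).le)
      fun k _ ↦ one_sub_norm_le hq hc k

lemma tendsto_qPoch (c : ℂ) {q : ℂ} (hq : ‖q‖ < 1) :
    Filter.Tendsto (qPoch c q) Filter.atTop (nhds (qPochInf c q)) := by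
  have h : Summable fun k : ℕ ↦ ‖-(c * q ^ k)‖ := by
    simpa [norm_mul, norm_pow] using
      (summable_geometric_of_lt_one (norm_nonneg q) hq).mul_left ‖c‖
  have := (multipliable_one_add_of_summable h).hasProd.tendsto_prod_nat
  simp only [← sub_eq_add_neg] at this
  exact this

lemma qPochInf_ne_zero {c q : ℂ} (hq : ‖q‖ < 1) (hc : ‖c‖ < 1) : qPochInf c q ≠ 0 := by
  have h : Summable fun k : ℕ ↦ ‖-(c * q ^ k)‖ := by
    simpa [norm_mul, norm_pow] using
      (summable_geometric_of_lt_one (norm_nonneg q) hq).mul_left ‖c‖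
  simpa only [qPochInf, ← sub_eq_add_neg] using
    tprod_one_add_ne_zero_of_summable
      (fun k ↦ by simpa only [← sub_eq_add_neg] using one_sub_ne_zero hq.le hc k) h

/-- Gaussian decay beats geometric growth. -/
lemma summable_pow_mul_pow {r : ℝ} (hr0 : 0 ≤ r) (hr : r < 1) {M : ℝ} (hM : 0 ≤ M) :
    Summable fun n : ℕ ↦ (r ^ n * M) ^ n := by
  have h0 : Filter.Tendsto (fun n : ℕ ↦ r ^ n * M) Filter.atTop (nhds 0) := by
    simpa using (tendsto_pow_atTop_nhds_zero_of_lt_one hr0 hr).mul_const M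
  refine Summable.of_norm_bounded_eventually_nat summable_geometric_two ?_
  filter_upwards [h0.eventually_le_const (show (0 : ℝ) < 1 / 2 by norm_num)] with n hn
  rw [Real.norm_of_nonneg (by positivity)]
  gcongr

/-- The `N`-th summand (from `N = 0`) of the Durfee-square expansion of
`(-azq;q)_∞ / (aq;q)_∞`. -/
noncomputable def durfeeTerm (q z a : ℂ) (N : ℕ) : ℂ :=
  q ^ ((N + 1) ^ 2) * (qPoch (-(a * z) * q) q N / qPoch (a * q) q N) *
    (a ^ (N + 1) * qPoch (-z) q (N + 1) / qPoch q q (N + 1)) *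
    (1 + (1 + z * q ^ (N + 1)) * (a * q ^ (N + 1) / (1 - a * q ^ (N + 1))))

/-- The defect, after `N` summands, of the `q`-difference equation satisfied by the
Durfee-square expansion. -/
noncomputable def durfeeRemainder (q z a : ℂ) (N : ℕ) : ℂ :=
  q ^ ((N + 1) ^ 2) * qPoch (-(a * z) * q) q N / qPoch (a * q * q) q N *
    (a ^ (N + 1) * qPoch (-z) q (N + 1) / qPoch q q N)

/-- A summable majorant of the Durfee-square expansion, uniform in `‖a‖ ≤ 1`. -/
noncomputable def durfeeBound (q z : ℂ) (N : ℕ) : ℝ :=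
  (1 + ‖z‖) * (‖q‖ ^ N * ((1 + ‖z‖) ^ 2 * (1 - ‖q‖)⁻¹ ^ 2)) ^ N

lemma summable_durfeeBound {q : ℂ} (hq : ‖q‖ < 1) (z : ℂ) : Summable (durfeeBound q z) :=
  (summable_pow_mul_pow (norm_nonneg q) hq (by positivity)).mul_left _

lemma norm_mul_le_right_of_le_one {a q : ℂ} (ha : ‖a‖ ≤ 1) : ‖a * q‖ ≤ ‖q‖ := by
  rw [norm_mul]
  exact mul_le_of_le_one_left (norm_nonneg _) ha

section Bounds

variable {q a z : ℂ} (hq : ‖q‖ < 1) (ha : ‖a‖ ≤ 1)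
include hq ha

lemma norm_durfee_core_le {c : ℂ} (hc : ‖c‖ ≤ ‖q‖) (N : ℕ) :
    ‖q ^ ((N + 1) ^ 2) * qPoch (-(a * z) * q) q N / qPoch c q N *
      (a ^ (N + 1) * qPoch (-z) q (N + 1) / qPoch q q N)‖ ≤ durfeeBound q z N := by
  have h1 : ‖q ^ ((N + 1) ^ 2)‖ ≤ ‖q‖ ^ (N * N) := by
    rw [norm_pow]
    exact pow_le_pow_of_le_one (norm_nonneg _) hq.le (by nlinarith)
  have h2 : ‖qPoch (-(a * z) * q) q N‖ ≤ (1 + ‖z‖) ^ N := by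
    refine norm_qPoch_le hq.le ?_ N
    rw [norm_mul, norm_neg, norm_mul]
    calc ‖a‖ * ‖z‖ * ‖q‖ ≤ 1 * ‖z‖ * 1 := by gcongr
      _ = ‖z‖ := by ring
  have h3 : ‖qPoch (-z) q (N + 1)‖ ≤ (1 + ‖z‖) ^ (N + 1) :=
    norm_qPoch_le hq.le (norm_neg z).le _
  have h4 : ‖a ^ (N + 1)‖ ≤ 1 := by
    rw [norm_pow]
    exact pow_le_one₀ (norm_nonneg _) ha
  have h5 := norm_inv_qPoch_le hq.le hc hq N
  have h6 := norm_inv_qPoch_le hq.le (le_refl ‖q‖) hq N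
  rw [div_eq_mul_inv, div_eq_mul_inv]
  simp only [norm_mul]
  calc _ ≤ ‖q‖ ^ (N * N) * (1 + ‖z‖) ^ N * (1 - ‖q‖)⁻¹ ^ N *
        (1 * (1 + ‖z‖) ^ (N + 1) * (1 - ‖q‖)⁻¹ ^ N) := by gcongr
    _ = durfeeBound q z N := by
      rw [durfeeBound, mul_pow, mul_pow, ← pow_mul, ← pow_mul, ← pow_mul]
      ring

lemma norm_durfeeRemainder_le (N : ℕ) : ‖durfeeRemainder q z a N‖ ≤ durfeeBound q z N :=
  norm_durfee_core_le hq ha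
    ((norm_mul_le_right_of_le_one ((norm_mul_le_right_of_le_one ha).trans hq.le))) N

lemma norm_durfeeTerm_le (N : ℕ) :
    ‖durfeeTerm q z a N‖ ≤
      durfeeBound q z N * ((1 - ‖q‖)⁻¹ * (1 + (1 + ‖z‖) * (1 - ‖q‖)⁻¹)) := by
  have hq' : 0 < 1 - ‖q‖ := sub_pos.mpr hq
  have haq := norm_mul_le_right_of_le_one (q := q) ha
  have h1 : ‖(1 - q * q ^ N)⁻¹‖ ≤ (1 - ‖q‖)⁻¹ := by
    rw [norm_inv]
    exact inv_anti₀ hq' (one_sub_norm_le hq.le le_rfl N)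
  have h2 : ‖(1 - a * q * q ^ N)⁻¹‖ ≤ (1 - ‖q‖)⁻¹ := by
    rw [norm_inv]
    exact inv_anti₀ hq' (one_sub_norm_le hq.le haq N)
  have h3 : ‖1 + z * q ^ (N + 1)‖ ≤ 1 + ‖z‖ := by
    refine (norm_add_le _ _).trans ?_
    rw [norm_one, norm_mul, norm_pow]
    gcongr
    exact mul_le_of_le_one_right (norm_nonneg _) (pow_le_one₀ (norm_nonneg _) hq.le)
  have h4 : ‖a * q ^ (N + 1)‖ ≤ 1 := by
    rw [norm_mul, norm_pow]
    exact mul_le_one₀ ha (by positivity) (pow_le_one₀ (norm_nonneg _) hq.le)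
  have h5 : ‖1 + (1 + z * q ^ (N + 1)) * (a * q ^ (N + 1) * (1 - a * q * q ^ N)⁻¹)‖ ≤
      1 + (1 + ‖z‖) * (1 - ‖q‖)⁻¹ := by
    refine (norm_add_le _ _).trans ?_
    rw [norm_one, norm_mul, norm_mul]
    calc _ ≤ 1 + (1 + ‖z‖) * (1 * (1 - ‖q‖)⁻¹) := by gcongr
      _ = _ := by ring
  have key : durfeeTerm q z a N =
      q ^ ((N + 1) ^ 2) * qPoch (-(a * z) * q) q N / qPoch (a * q) q N *
        (a ^ (N + 1) * qPoch (-z) q (N + 1) / qPoch q q N) *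
      ((1 - q * q ^ N)⁻¹ *
        (1 + (1 + z * q ^ (N + 1)) * (a * q ^ (N + 1) * (1 - a * q * q ^ N)⁻¹))) := by
    rw [durfeeTerm, qPoch_succ q]
    simp only [div_eq_mul_inv, mul_inv]
    ring
  rw [key, norm_mul, norm_mul (_⁻¹)]
  have hcore := norm_durfee_core_le (z := z) hq ha haq N
  have := (norm_nonneg _).trans hcore
  gcongr

lemma durfee_partial_sum (n : ℕ) :
    (1 - a * q) * (1 + ∑ N ∈ Finset.range n, durfeeTerm q z a N) -
      (1 + a * z * q) * (1 + ∑ N ∈ Finset.range n, durfeeTerm q z (a * q) N) =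
    -durfeeRemainder q z a n := by
  have haq : ‖a * q‖ < 1 := (norm_mul_le_right_of_le_one ha).trans_lt hq
  have haqq : ‖a * q * q‖ < 1 := (norm_mul_le_right_of_le_one haq.le).trans_lt hq
  induction n with
  | zero => simp [durfeeRemainder, qPoch]; ring
  | succ n ih =>
    rw [Finset.sum_range_succ, Finset.sum_range_succ]
    suffices h : (1 - a * q) * durfeeTerm q z a n - (1 + a * z * q) * durfeeTerm q z (a * q) n =
        durfeeRemainder q z a n - durfeeRemainder q z a (n + 1) by
      linear_combination ih + h
    have e1 : (1 + a * z * q) * qPoch (-(a * q * z) * q) q n =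
        qPoch (-(a * z) * q) q n * (1 + a * z * q * q ^ n) := by
      have := (qPoch_succ' (-(a * z) * q) q n).symm.trans (qPoch_succ _ q n)
      rw [show -(a * q * z) * q = -(a * z) * q * q by ring]
      linear_combination this
    have e2 : (1 - a * q) * qPoch (a * q * q) q n = qPoch (a * q) q n * (1 - a * q * q ^ n) :=
      (qPoch_succ' (a * q) q n).symm.trans (qPoch_succ _ q n)
    have e1' : (1 + a * z * q) * durfeeTerm q z (a * q) n =
      q ^ ((n + 1) ^ 2) * (qPoch (-(a * z) * q) q n * (1 + a * z * q * q ^ n) /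
        qPoch (a * q * q) q n) *
      ((a * q) ^ (n + 1) * qPoch (-z) q (n + 1) / qPoch q q (n + 1)) *
      (1 + (1 + z * q ^ (n + 1)) * (a * q * q ^ (n + 1) / (1 - a * q * q ^ (n + 1)))) := by
      rw [← e1, durfeeTerm]
      ring
    have n1 : 1 - a * q ≠ 0 := by simpa using one_sub_ne_zero hq.le haq 0
    have n2 : 1 - a * q * q ^ n ≠ 0 := one_sub_ne_zero hq.le haq n
    have n3 : 1 - a * q ^ 2 * q ^ n ≠ 0 := by
      simpa only [pow_two, mul_assoc] using one_sub_ne_zero hq.le haqq n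
    have n4 : 1 - q * q ^ n ≠ 0 := one_sub_ne_zero hq.le hq n
    have n5 := qPoch_ne_zero hq.le haq n
    have n6 := qPoch_ne_zero hq.le hq n
    have e2' : qPoch (a * q * q) q n = qPoch (a * q) q n * (1 - a * q * q ^ n) / (1 - a * q) := by
      rw [← e2, mul_div_cancel_left₀ _ n1]
    have p : q ^ ((n + 1 + 1) ^ 2) = q ^ ((n + 1) ^ 2) * (q ^ n) ^ 2 * q ^ 3 := by
      rw [← pow_mul, ← pow_add, ← pow_add]
      congr 1
      ring
    rw [e1', durfeeTerm, durfeeRemainder, durfeeRemainder, qPoch_succ (-(a * z) * q),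
      qPoch_succ (a * q * q), qPoch_succ q q n, qPoch_succ (-z) q (n + 1), e2', mul_pow a q, p,
      pow_succ a (n + 1), pow_succ' q n]
    clear e1 e2 e1' e2' p ih
    generalize qPoch (-(a * z) * q) q n = X
    generalize qPoch (a * q) q n = Y at *
    generalize qPoch (-z) q (n + 1) = Z
    generalize qPoch q q n = W at *
    generalize q ^ ((n + 1) ^ 2) = G
    generalize a ^ (n + 1) = A
    generalize q ^ n = x at *
    rw [show a * q * q * x = a * q ^ 2 * x by ring, show a * q * (q * x) = a * q ^ 2 * x by ring,
      show a * (q * x) = a * q * x by ring]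
    field_simp
    ring

lemma summable_durfeeTerm : Summable fun N ↦ ‖durfeeTerm q z a N‖ :=
  Summable.of_nonneg_of_le (fun _ ↦ norm_nonneg _) (norm_durfeeTerm_le hq ha)
    ((summable_durfeeBound hq z).mul_right _)

lemma durfee_functional_equation :
    (1 - a * q) * (1 + ∑' N, durfeeTerm q z a N) =
      (1 + a * z * q) * (1 + ∑' N, durfeeTerm q z (a * q) N) := by
  have haq := (norm_mul_le_right_of_le_one ha).trans hq.le
  have hs {b : ℂ} (hb : ‖b‖ ≤ 1) :=
    ((summable_durfeeTerm (z := z) hq hb).of_norm).hasSum.tendsto_sum_nat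
  have h0 : Filter.Tendsto (durfeeRemainder q z a) Filter.atTop (nhds 0) :=
    squeeze_zero_norm (norm_durfeeRemainder_le hq ha)
      (summable_durfeeBound hq z).tendsto_atTop_zero
  have h1 := (((hs ha).const_add 1).const_mul (1 - a * q)).sub
    (((hs haq).const_add 1).const_mul (1 + a * z * q))
  simp only [durfee_partial_sum hq ha] at h1
  exact sub_eq_zero.mp ((tendsto_nhds_unique h1 h0.neg).trans neg_zero)

lemma durfee_iterate (n : ℕ) :
    qPoch (a * q) q n * (1 + ∑' N, durfeeTerm q z a N) =
      qPoch (-(a * z) * q) q n * (1 + ∑' N, durfeeTerm q z (a * q ^ n) N) := by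
  induction n with
  | zero => simp [qPoch]
  | succ n ih =>
    have hb : ‖a * q ^ n‖ ≤ 1 := by
      rw [norm_mul, norm_pow]
      exact mul_le_one₀ ha (by positivity) (pow_le_one₀ (norm_nonneg _) hq.le)
    have h := durfee_functional_equation (z := z) hq hb
    rw [show a * q ^ n * q = a * q ^ (n + 1) by ring] at h
    rw [qPoch_succ, qPoch_succ]
    linear_combination (1 - a * q * q ^ n) * ih + qPoch (-(a * z) * q) q n * h

lemma tendsto_tsum_durfeeTerm :
    Filter.Tendsto (fun n : ℕ ↦ ∑' N, durfeeTerm q z (a * q ^ n) N) Filter.atTop (nhds 0) := by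
  have hb (n : ℕ) : ‖a * q ^ n‖ ≤ 1 := by
    rw [norm_mul, norm_pow]
    exact mul_le_one₀ ha (by positivity) (pow_le_one₀ (norm_nonneg _) hq.le)
  have h0 : Filter.Tendsto (fun n : ℕ ↦ a * q ^ n) Filter.atTop (nhds 0) := by
    simpa using (tendsto_pow_atTop_nhds_zero_of_norm_lt_one hq).const_mul a
  have hcont (N : ℕ) : ContinuousAt (fun b ↦ durfeeTerm q z b N) 0 := by
    have hq0 := qPoch_ne_zero hq.le hq (N + 1)
    unfold durfeeTerm qPoch at *
    fun_prop (disch := simp_all)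
  have hz (N : ℕ) : durfeeTerm q z 0 N = 0 := by simp [durfeeTerm]
  have := tendsto_tsum_of_dominated_convergence (𝓕 := Filter.atTop)
    (f := fun n N ↦ durfeeTerm q z (a * q ^ n) N) (g := fun _ ↦ 0)
    ((summable_durfeeBound hq z).mul_right _)
    (fun N ↦ by simpa only [hz, Function.comp_def] using (hcont N).tendsto.comp h0)
    (Filter.Eventually.of_forall fun n N ↦ norm_durfeeTerm_le hq (hb n) N)
  simpa using this

end Bounds

/-- Theorem 1.2 for `r = 1`:
`(-azq;q)_∞ / (aq;q)_∞ = 1 + Σ_{N=1}^∞ q^{N²} [(-azq;q)_{N-1}/(aq;q)_{N-1}]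
  [a^N (-z;q)_N/(q;q)_N] (1 + (1 + z q^N) a q^N/(1 - a q^N))`,
the series converging absolutely. -/
theorem overpartition_identity_r1 (q a z : ℂ) (hq0 : 0 < ‖q‖) (hq : ‖q‖ < 1)
    (ha : ‖a‖ < 1) :
    Summable (fun N : ℕ =>
      ‖q ^ ((N + 1) ^ 2) * (qPoch (-(a * z) * q) q N / qPoch (a * q) q N) *
        (a ^ (N + 1) * qPoch (-z) q (N + 1) / qPoch q q (N + 1)) *
        (1 + (1 + z * q ^ (N + 1)) * (a * q ^ (N + 1) / (1 - a * q ^ (N + 1))))‖) ∧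
    qPochInf (-(a * z) * q) q / qPochInf (a * q) q =
      1 + ∑' N : ℕ, q ^ ((N + 1) ^ 2) * (qPoch (-(a * z) * q) q N / qPoch (a * q) q N) *
        (a ^ (N + 1) * qPoch (-z) q (N + 1) / qPoch q q (N + 1)) *
        (1 + (1 + z * q ^ (N + 1)) * (a * q ^ (N + 1) / (1 - a * q ^ (N + 1)))) := by
  refine ⟨summable_durfeeTerm hq ha.le, ?_⟩
  have haq : ‖a * q‖ < 1 := (norm_mul_le_right_of_le_one ha.le).trans_lt hq
  rw [div_eq_iff (qPochInf_ne_zero hq haq)]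
  have h1 := (tendsto_qPoch (a * q) hq).mul_const (1 + ∑' N, durfeeTerm q z a N)
  have h2 := (tendsto_qPoch (-(a * z) * q) hq).mul
    ((tendsto_tsum_durfeeTerm (z := z) hq ha.le).const_add 1)
  simp only [← durfee_iterate hq ha.le, add_zero, mul_one] at h2
  exact (tendsto_nhds_unique h2 h1).trans (mul_comm _ _)
end

section
/- (Dousse–Kim identity) Let q ∈ ℂ with 0 < |q| < 1 and let a ∈ ℂ with |a| < 1. Then (-aq;q)_∞ / (aq;q)_∞ = 1 + Σ_{N=1}^∞ ([(-q;q)_{N-1} (-aq;q)_{N-1} / ((q;q)_{N-1} (aq;q)_{N-1})] a^N q^{N²} + [(-q;q)_N (-aq;q)_N / ((q;q)_N (aq;q)_N)] a^N q^{N²}), where the series converges absolutely and all denominators are nonzero. -/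
open Filter Topology

/-- The coefficient `(-q;q)_N (-aq;q)_N / ((q;q)_N (aq;q)_N)`. -/
noncomputable def qPochRatio (q a : ℂ) (N : ℕ) : ℂ :=
  qPoch (-q) q N * qPoch (-a * q) q N / (qPoch q q N * qPoch (a * q) q N)

/-- The `N`-th summand of the Dousse–Kim series. -/
noncomputable def dousseKimTerm (q a : ℂ) (N : ℕ) : ℂ :=
  qPochRatio q a N * a ^ (N + 1) * q ^ ((N + 1) ^ 2) +
    qPochRatio q a (N + 1) * a ^ (N + 1) * q ^ ((N + 1) ^ 2)

lemma norm_mul_pow_succ_le {q b : ℂ} (hq : ‖q‖ < 1) (hb : ‖b‖ ≤ 1) (N : ℕ) :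
    ‖b * q ^ (N + 1)‖ ≤ ‖q‖ := by
  rw [norm_mul, norm_pow]
  calc ‖b‖ * ‖q‖ ^ (N + 1) ≤ 1 * ‖q‖ ^ 1 := by
        gcongr ?_ * ?_
        exact pow_le_pow_of_le_one (norm_nonneg _) hq.le (by omega)
    _ = ‖q‖ := by ring

lemma one_sub_norm_le_s9 {q z : ℂ} (hz : ‖z‖ ≤ ‖q‖) : 1 - ‖q‖ ≤ ‖1 - z‖ := by
  have := norm_sub_norm_le (1 : ℂ) z
  rw [norm_one] at this
  linarith

lemma one_sub_ne_zero_of_norm_lt_one {z : ℂ} (hz : ‖z‖ < 1) : 1 - z ≠ 0 := by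
  intro h
  rw [← sub_eq_zero.mp h, norm_one] at hz
  exact lt_irrefl _ hz

lemma one_add_ne_zero_of_norm_lt_one {z : ℂ} (hz : ‖z‖ < 1) : 1 + z ≠ 0 := by
  have := one_sub_ne_zero_of_norm_lt_one (z := -z) (by rwa [norm_neg])
  rwa [sub_neg_eq_add] at this

lemma norm_one_add_div_one_sub_le {q z : ℂ} (hq : ‖q‖ < 1) (hz : ‖z‖ ≤ ‖q‖) :
    ‖(1 + z) / (1 - z)‖ ≤ 2 / (1 - ‖q‖) := by
  rw [norm_div]
  have h : ‖1 + z‖ ≤ 2 := (norm_add_le _ _).trans (by rw [norm_one]; linarith)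
  have h' := one_sub_norm_le_s9 hz
  have : 0 < 1 - ‖q‖ := by linarith
  gcongr

lemma qPoch_mul_ne_zero {q b : ℂ} (hq : ‖q‖ < 1) (hb : ‖b‖ ≤ 1) (N : ℕ) :
    qPoch (b * q) q N ≠ 0 := by
  refine Finset.prod_ne_zero_iff.mpr fun k _ => one_sub_ne_zero_of_norm_lt_one ?_
  rw [mul_assoc, ← pow_succ']
  exact (norm_mul_pow_succ_le hq hb k).trans_lt hq

lemma qPochRatio_succ (q a : ℂ) (N : ℕ) :
    qPochRatio q a (N + 1) = qPochRatio q a N *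
      ((1 + q ^ (N + 1)) / (1 - q ^ (N + 1)) *
        ((1 + a * q ^ (N + 1)) / (1 - a * q ^ (N + 1)))) := by
  simp only [qPochRatio, qPoch, Finset.prod_range_succ]
  rw [div_mul_div_comm, div_mul_div_comm]
  congr 1 <;> ring

lemma norm_qPochRatio_le {q a : ℂ} (hq : ‖q‖ < 1) (ha : ‖a‖ ≤ 1) (N : ℕ) :
    ‖qPochRatio q a N‖ ≤ (2 / (1 - ‖q‖)) ^ (2 * N) := by
  induction N with
  | zero => simp [qPochRatio, qPoch]
  | succ N ih =>
    have h1 := norm_one_add_div_one_sub_le hq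
      (norm_mul_pow_succ_le (b := 1) hq (by simp) N)
    rw [one_mul] at h1
    have h2 := norm_one_add_div_one_sub_le hq (norm_mul_pow_succ_le hq ha N)
    rw [qPochRatio_succ, norm_mul, norm_mul]
    calc _ ≤ (2 / (1 - ‖q‖)) ^ (2 * N) * (2 / (1 - ‖q‖) * (2 / (1 - ‖q‖))) := by gcongr
      _ = _ := by ring

lemma qPochRatio_mul_self {q a : ℂ} (hq : ‖q‖ < 1) (ha : ‖a‖ < 1) (N : ℕ) :
    qPochRatio q (a * q) N = qPochRatio q a N *
      ((1 + a * q ^ (N + 1)) * (1 - a * q) / ((1 - a * q ^ (N + 1)) * (1 + a * q))) := by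
  have hz : ∀ k : ℕ, ‖a * q ^ (k + 1)‖ < 1 := fun k =>
    (norm_mul_pow_succ_le hq ha.le k).trans_lt hq
  have h0 := hz 0
  simp only [zero_add, pow_one] at h0
  have hs0 := one_sub_ne_zero_of_norm_lt_one h0
  have ha0 := one_add_ne_zero_of_norm_lt_one h0
  induction N with
  | zero => simp [qPochRatio, qPoch]; field_simp
  | succ N ih =>
    have h1 := one_sub_ne_zero_of_norm_lt_one (hz N)
    have h2 := one_sub_ne_zero_of_norm_lt_one (hz (N + 1))
    have e : a * q * q ^ (N + 1) = a * q ^ (N + 1 + 1) := by ring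
    rw [qPochRatio_succ, qPochRatio_succ, ih, e]
    field_simp

/-- Telescoping form of the `q`-difference equation `(1 - aq) F(a) = (1 + aq) F(aq)`. -/
lemma dousseKim_partial_sum {q a : ℂ} (hq : ‖q‖ < 1) (ha : ‖a‖ < 1) (n : ℕ) :
    (1 - a * q) * (1 + ∑ N ∈ Finset.range n, dousseKimTerm q a N) -
      (1 + a * q) * (1 + ∑ N ∈ Finset.range n, dousseKimTerm q (a * q) N) =
    (1 - a * q) * (-2 * (qPochRatio q a n * a ^ (n + 1) * q ^ ((n + 1) ^ 2)) /
      (1 - a * q ^ (n + 1))) := by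
  have hz : ∀ k : ℕ, 1 - a * q ^ (k + 1) ≠ 0 := fun k =>
    one_sub_ne_zero_of_norm_lt_one ((norm_mul_pow_succ_le hq ha.le k).trans_lt hq)
  have h0 : ‖a * q‖ < 1 := by simpa using (norm_mul_pow_succ_le hq ha.le 0).trans_lt hq
  have hs0 := one_sub_ne_zero_of_norm_lt_one h0
  have ha0 := one_add_ne_zero_of_norm_lt_one h0
  induction n with
  | zero => simp [qPochRatio, qPoch]; field_simp; ring
  | succ n ih =>
    have hy : 1 - q ^ (n + 1) ≠ 0 := one_sub_ne_zero_of_norm_lt_one (by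
      simpa using (norm_mul_pow_succ_le (b := 1) hq (by simp) n).trans_lt hq)
    have h1 := hz n
    have h2 := hz (n + 1)
    rw [Finset.sum_range_succ, Finset.sum_range_succ]
    have step : (1 - a * q) * dousseKimTerm q a n - (1 + a * q) * dousseKimTerm q (a * q) n =
        (1 - a * q) * (-2 * (qPochRatio q a (n + 1) * a ^ (n + 1 + 1) * q ^ ((n + 1 + 1) ^ 2)) /
          (1 - a * q ^ (n + 1 + 1))) - (1 - a * q) *
          (-2 * (qPochRatio q a n * a ^ (n + 1) * q ^ ((n + 1) ^ 2)) / (1 - a * q ^ (n + 1))) := by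
      have e1 : q ^ ((n + 1 + 1) ^ 2) = q ^ ((n + 1) ^ 2) * (q ^ (n + 1)) ^ 2 * q := by ring
      have e2 : (a * q) ^ (n + 1) = a ^ (n + 1) * q ^ (n + 1) := mul_pow _ _ _
      have e3 : q ^ (n + 1 + 1) = q ^ (n + 1) * q := pow_succ _ _
      have e4 : a ^ (n + 1 + 1) = a ^ (n + 1) * a := pow_succ _ _
      rw [e3, mul_comm _ q, ← mul_assoc] at h2
      simp only [dousseKimTerm]
      rw [qPochRatio_mul_self hq ha, qPochRatio_mul_self hq ha, qPochRatio_succ, e1, e2, e3, e4]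
      generalize q ^ ((n + 1) ^ 2) = Q
      generalize a ^ (n + 1) = A
      generalize q ^ (n + 1) = y at *
      generalize qPochRatio q a n = w
      field_simp
      ring
    linear_combination ih + step

/-- A majorant for the Dousse–Kim series, uniform in `‖a‖ ≤ 1`. -/
noncomputable def dousseKimBound (r : ℝ) (N : ℕ) : ℝ :=
  2 * (2 / (1 - r)) ^ (2 * N + 2) * r ^ ((N + 1) ^ 2)

lemma summable_dousseKimBound {r : ℝ} (h0 : 0 < r) (h1 : r < 1) :
    Summable (dousseKimBound r) := by
  have hK : 0 < 2 / (1 - r) := div_pos two_pos (by linarith)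
  have hpos : ∀ N, 0 < dousseKimBound r N := fun N => by unfold dousseKimBound; positivity
  refine summable_of_ratio_test_tendsto_lt_one zero_lt_one
    (Eventually.of_forall fun N => (hpos N).ne') ?_
  have hr : ∀ N, ‖dousseKimBound r (N + 1)‖ / ‖dousseKimBound r N‖ =
      (2 / (1 - r)) ^ 2 * r ^ 3 * (r ^ 2) ^ N := fun N => by
    rw [Real.norm_of_nonneg (hpos _).le, Real.norm_of_nonneg (hpos _).le, div_eq_iff (hpos N).ne']
    unfold dousseKimBound
    ring
  simp_rw [hr]
  simpa using (tendsto_pow_atTop_nhds_zero_of_lt_one (sq_nonneg r)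
    (by nlinarith)).const_mul ((2 / (1 - r)) ^ 2 * r ^ 3)

lemma norm_qPochRatio_mul_le {q a : ℂ} (hq : ‖q‖ < 1) (ha : ‖a‖ ≤ 1) {m N : ℕ}
    (hm : m ≤ N + 1) :
    ‖qPochRatio q a m * a ^ (N + 1) * q ^ ((N + 1) ^ 2)‖ ≤ ‖a‖ * (dousseKimBound ‖q‖ N / 2) := by
  have hK : 1 ≤ 2 / (1 - ‖q‖) := by
    rw [le_div_iff₀ (by linarith)]; linarith [norm_nonneg q]
  have hw : ‖qPochRatio q a m‖ ≤ (2 / (1 - ‖q‖)) ^ (2 * N + 2) :=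
    (norm_qPochRatio_le hq ha m).trans (pow_le_pow_right₀ hK (by omega))
  have hp : ‖a‖ ^ (N + 1) ≤ ‖a‖ := pow_le_of_le_one (norm_nonneg _) ha (by omega)
  rw [norm_mul, norm_mul, norm_pow, norm_pow]
  calc _ ≤ (2 / (1 - ‖q‖)) ^ (2 * N + 2) * ‖a‖ * ‖q‖ ^ ((N + 1) ^ 2) := by gcongr
    _ = _ := by unfold dousseKimBound; ring

lemma norm_dousseKimTerm_le {q a : ℂ} (hq : ‖q‖ < 1) (ha : ‖a‖ ≤ 1) (N : ℕ) :
    ‖dousseKimTerm q a N‖ ≤ ‖a‖ * dousseKimBound ‖q‖ N := by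
  refine (norm_add_le _ _).trans ?_
  linarith [norm_qPochRatio_mul_le hq ha (m := N) (N := N) (by omega),
    norm_qPochRatio_mul_le hq ha (m := N + 1) (N := N) le_rfl]

lemma summable_norm_dousseKimTerm {q a : ℂ} (hq0 : 0 < ‖q‖) (hq : ‖q‖ < 1) (ha : ‖a‖ ≤ 1) :
    Summable fun N => ‖dousseKimTerm q a N‖ :=
  ((summable_dousseKimBound hq0 hq).mul_left ‖a‖).of_nonneg_of_le (fun _ => norm_nonneg _)
    (norm_dousseKimTerm_le hq ha)

lemma dousseKim_functional_equation {q a : ℂ} (hq0 : 0 < ‖q‖) (hq : ‖q‖ < 1) (ha : ‖a‖ < 1) :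
    (1 - a * q) * (1 + ∑' N, dousseKimTerm q a N) =
      (1 + a * q) * (1 + ∑' N, dousseKimTerm q (a * q) N) := by
  have haq : ‖a * q‖ ≤ 1 := by
    simpa using (norm_mul_pow_succ_le hq ha.le 0).trans hq.le
  have t1 := (summable_norm_dousseKimTerm hq0 hq ha.le).of_norm.tendsto_sum_tsum_nat
  have t2 := (summable_norm_dousseKimTerm hq0 hq haq).of_norm.tendsto_sum_tsum_nat
  have t := ((t1.const_add 1).const_mul (1 - a * q)).sub ((t2.const_add 1).const_mul (1 + a * q))
  have hB : Tendsto (fun n => 2 * (‖a‖ * (dousseKimBound ‖q‖ n / 2)) / (1 - ‖q‖)) atTop (𝓝 0) := by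
    simpa using (((((summable_dousseKimBound hq0 hq).tendsto_atTop_zero.div_const 2).const_mul
      ‖a‖).const_mul 2).div_const (1 - ‖q‖))
  have hE : Tendsto (fun n : ℕ => -2 * (qPochRatio q a n * a ^ (n + 1) * q ^ ((n + 1) ^ 2)) /
      (1 - a * q ^ (n + 1))) atTop (𝓝 0) := by
    refine squeeze_zero_norm (fun n => ?_) hB
    have h1 := norm_qPochRatio_mul_le hq ha.le (m := n) (N := n) (by omega)
    have h2 := one_sub_norm_le_s9 (norm_mul_pow_succ_le hq ha.le n)
    have h3 : 0 < 1 - ‖q‖ := by linarith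
    rw [norm_div, norm_mul, norm_neg, Complex.norm_two]
    have h4 := (norm_nonneg _).trans h1
    gcongr
  simp_rw [dousseKim_partial_sum hq ha] at t
  have := tendsto_nhds_unique t (by simpa using hE.const_mul (1 - a * q))
  exact sub_eq_zero.mp this

lemma qPoch_mul_dousseKim {q a : ℂ} (hq0 : 0 < ‖q‖) (hq : ‖q‖ < 1) (ha : ‖a‖ < 1) (n : ℕ) :
    qPoch (a * q) q n * (1 + ∑' N, dousseKimTerm q a N) =
      qPoch (-a * q) q n * (1 + ∑' N, dousseKimTerm q (a * q ^ n) N) := by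
  induction n with
  | zero => simp [qPoch]
  | succ n ih =>
    have han : ‖a * q ^ n‖ < 1 := by
      rw [norm_mul, norm_pow]
      exact (mul_le_of_le_one_right (norm_nonneg _)
        (pow_le_one₀ (norm_nonneg _) hq.le)).trans_lt ha
    have hf := dousseKim_functional_equation hq0 hq han
    rw [mul_assoc a, ← pow_succ] at hf
    simp only [qPoch, Finset.prod_range_succ] at ih ⊢
    linear_combination (1 - a * q ^ (n + 1)) * ih +
      (∏ k ∈ Finset.range n, (1 - -a * q * q ^ k)) * hf

lemma tendsto_dousseKim_one {q a : ℂ} (hq0 : 0 < ‖q‖) (hq : ‖q‖ < 1) (ha : ‖a‖ < 1) :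
    Tendsto (fun n : ℕ => 1 + ∑' N, dousseKimTerm q (a * q ^ n) N) atTop (𝓝 1) := by
  have hz : Tendsto (fun n : ℕ => a * q ^ n) atTop (𝓝 0) := by
    simpa using (tendsto_pow_atTop_nhds_zero_of_norm_lt_one hq).const_mul a
  have hB : Tendsto (fun n : ℕ => ‖a * q ^ n‖ * ∑' N, dousseKimBound ‖q‖ N) atTop (𝓝 0) := by
    simpa using hz.norm.mul_const (∑' N, dousseKimBound ‖q‖ N)
  have : Tendsto (fun n : ℕ => ∑' N, dousseKimTerm q (a * q ^ n) N) atTop (𝓝 0) := by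
    refine squeeze_zero_norm (fun n => ?_) hB
    have han : ‖a * q ^ n‖ ≤ 1 := by
      rw [norm_mul, norm_pow]
      exact mul_le_one₀ ha.le (by positivity) (pow_le_one₀ (norm_nonneg _) hq.le)
    exact tsum_of_norm_bounded ((summable_dousseKimBound hq0 hq).hasSum.mul_left _)
      (norm_dousseKimTerm_le hq han)
  simpa using this.const_add 1

lemma summable_norm_neg_mul_pow {q : ℂ} (hq : ‖q‖ < 1) (b : ℂ) :
    Summable fun k : ℕ => ‖-(b * q ^ k)‖ := by
  simp_rw [norm_neg, norm_mul, norm_pow]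
  exact (summable_geometric_of_lt_one (norm_nonneg _) hq).mul_left _

lemma tendsto_qPoch_s9 {q : ℂ} (hq : ‖q‖ < 1) (b : ℂ) :
    Tendsto (qPoch b q) atTop (𝓝 (qPochInf b q)) := by
  have := (multipliable_one_add_of_summable (summable_norm_neg_mul_pow hq b)).tendsto_prod_tprod_nat
  simp only [← sub_eq_add_neg] at this
  exact this

lemma qPochInf_ne_zero_s9 {q b : ℂ} (hq : ‖q‖ < 1) (hb : ∀ k : ℕ, 1 - b * q ^ k ≠ 0) :
    qPochInf b q ≠ 0 := by
  have := tprod_one_add_ne_zero_of_summable (f := fun k : ℕ => -(b * q ^ k))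
    (fun k => by rw [← sub_eq_add_neg]; exact hb k) (summable_norm_neg_mul_pow hq b)
  simp only [← sub_eq_add_neg] at this
  exact this

/-- The Dousse–Kim identity: for `0 < |q| < 1` and `|a| < 1`,
`(-aq;q)_∞/(aq;q)_∞ = 1 + Σ_{N=1}^∞ ([(-q;q)_{N-1}(-aq;q)_{N-1}/((q;q)_{N-1}(aq;q)_{N-1})] a^N q^{N²}
 + [(-q;q)_N(-aq;q)_N/((q;q)_N(aq;q)_N)] a^N q^{N²})`,
the series converging absolutely, with all denominators nonzero. -/
theorem dousse_kim_identity (q a : ℂ) (hq0 : 0 < ‖q‖) (hq : ‖q‖ < 1) (ha : ‖a‖ < 1) :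
    (∀ N : ℕ, qPoch q q N ≠ 0 ∧ qPoch (a * q) q N ≠ 0) ∧
    Summable (fun N : ℕ =>
      ‖qPoch (-q) q N * qPoch (-a * q) q N / (qPoch q q N * qPoch (a * q) q N) *
          a ^ (N + 1) * q ^ ((N + 1) ^ 2) +
        qPoch (-q) q (N + 1) * qPoch (-a * q) q (N + 1) /
          (qPoch q q (N + 1) * qPoch (a * q) q (N + 1)) * a ^ (N + 1) * q ^ ((N + 1) ^ 2)‖) ∧
    qPochInf (-a * q) q / qPochInf (a * q) q =
      1 + ∑' N : ℕ,
        (qPoch (-q) q N * qPoch (-a * q) q N / (qPoch q q N * qPoch (a * q) q N) *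
            a ^ (N + 1) * q ^ ((N + 1) ^ 2) +
          qPoch (-q) q (N + 1) * qPoch (-a * q) q (N + 1) /
            (qPoch q q (N + 1) * qPoch (a * q) q (N + 1)) * a ^ (N + 1) * q ^ ((N + 1) ^ 2)) := by
  have hne : ∀ k : ℕ, 1 - a * q * q ^ k ≠ 0 := fun k => by
    rw [mul_assoc, ← pow_succ']
    exact one_sub_ne_zero_of_norm_lt_one ((norm_mul_pow_succ_le hq ha.le k).trans_lt hq)
  refine ⟨fun N => ⟨?_, qPoch_mul_ne_zero hq ha.le N⟩,
    summable_norm_dousseKimTerm hq0 hq ha.le, ?_⟩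
  · simpa using qPoch_mul_ne_zero (b := 1) hq (by simp) N
  · change _ = 1 + ∑' N, dousseKimTerm q a N
    rw [div_eq_iff (qPochInf_ne_zero_s9 hq hne), mul_comm (1 + _)]
    have hl := (tendsto_qPoch_s9 hq (a * q)).mul_const (1 + ∑' N, dousseKimTerm q a N)
    simp_rw [qPoch_mul_dousseKim hq0 hq ha] at hl
    have hr := (tendsto_qPoch_s9 hq (-a * q)).mul (tendsto_dousseKim_one hq0 hq ha)
    rw [mul_one] at hr
    exact tendsto_nhds_unique hr hl
end
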